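/- arXiv:1203.4132 — 2 statements merged into one kernel-verified Lean document; each statement's English description precedes it below -/
import Mathlib

section
/- Let s ∈ ℝ and let g be log-admissible with associated functions a, b, and let r_x be the unique solution of a(r) = x. Define G_{n,s} by Σ_{n=0}^∞ G_{n,s} t^n = exp(e^{−s} g(t)). Then as n → ∞, G_{n,s} = (2π)^{−1/2} e^{s/2} r_{e^s n}^{−n} b(r_{e^s n})^{−1/2} exp(e^{−s} g(r_{e^s n})) (1 + o(1)), with the implied error uniform in s for s in any fixed compact set. -/
open Filter Set Asymptotics MeasureTheory
open scoped Topology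

noncomputable section

/-- `log`-admissibility of a power series `g` with coefficients `gc`, radius of
convergence `ρ`, and associated functions `a`, `b`, `δ` (Definition 2.1). -/
structure IsLogAdmissible (g : ℂ → ℂ) (gc : ℕ → ℝ) (ρ : ℝ) (a b δ : ℝ → ℝ) : Prop where
  rho_pos : 0 < ρ
  coeff_nonneg : ∀ n, 0 ≤ gc n
  series : ∀ z : ℂ, ‖z‖ < ρ → HasSum (fun n => (gc n : ℂ) * z ^ n) (g z)
  radius : ∀ t : ℝ, ρ < t → ¬ Summable fun n => gc n * t ^ n
  a_nonneg : ∀ r ∈ Set.Ico (0 : ℝ) ρ, 0 ≤ a r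
  b_nonneg : ∀ r ∈ Set.Ico (0 : ℝ) ρ, 0 ≤ b r
  delta_pos : ∀ r ∈ Set.Ico (0 : ℝ) ρ, 0 < δ r
  /-- approximation: `g(re^{iφ}) = g(r) + iφa(r) - φ²b(r)/2 + R(r,φ)` with
  `R(r,φ) = o(φ³ δ(r)⁻³)` uniformly in `φ` as `r → ρ`. -/
  approx : ∃ ε : ℝ → ℝ, Tendsto ε (𝓝[<] ρ) (𝓝 0) ∧
    ∀ r ∈ Set.Ico (0 : ℝ) ρ, ∀ φ : ℝ, |φ| ≤ δ r →
      ‖g (r * Complex.exp (φ * Complex.I)) -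
          (g r + φ * Complex.I * a r - (φ : ℂ) ^ 2 / 2 * b r)‖ ≤
        ε r * |φ| ^ 3 * (δ r)⁻¹ ^ 3
  a_div : Tendsto a (𝓝[<] ρ) atTop
  b_div : Tendsto b (𝓝[<] ρ) atTop
  delta_lim : Tendsto δ (𝓝[<] ρ) (𝓝 0)
  width : ∀ ε : ℝ, 0 < ε →
    Tendsto (fun r => ε * δ r ^ 2 * b r - Real.log (b r)) (𝓝[<] ρ) atTop
  mono : ∀ r ∈ Set.Ico (0 : ℝ) ρ, ∀ φ : ℝ, δ r < |φ| → |φ| ≤ Real.pi →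
    (g (r * Complex.exp (φ * Complex.I))).re ≤
      max (g (r * Complex.exp (δ r * Complex.I))).re
        (g (r * Complex.exp (-δ r * Complex.I))).re

/-- The technical condition (*): `|r_x^{(k)}| x^k ≲ |r_x^{(k-1)}| x^{k-1}` for
all sufficiently large `x` and `2 ≤ k ≤ 4`. -/
def TechCond (r : ℝ → ℝ) : Prop :=
  ∃ C > 0, ∃ x₀ : ℝ, ∀ x ≥ x₀, ∀ k : ℕ, 2 ≤ k → k ≤ 4 →
    |iteratedDeriv k r x| * x ^ k ≤ C * |iteratedDeriv (k - 1) r x| * x ^ (k - 1)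

/-- The sum of a complex power series converging on a disc is holomorphic there. -/
theorem differentiableOn_of_hasSum_pow {u : ℕ → ℂ} {f : ℂ → ℂ} {ρ : ℝ}
    (hf : ∀ z : ℂ, ‖z‖ < ρ → HasSum (fun n => u n * z ^ n) (f z)) :
    DifferentiableOn ℂ f (Metric.ball 0 ρ) := by
  intro z hz
  have hz' : ‖z‖ < ρ := by simpa using hz
  obtain ⟨c, hzc, hcρ⟩ := exists_between hz'
  have hc : 0 ≤ c := (norm_nonneg z).trans hzc.le
  have hsum : Summable fun n => ‖u n‖ * c ^ n := by
    have h := (hf c (by simpa [abs_of_nonneg hc] using hcρ)).summable.norm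
    simpa [abs_of_nonneg hc] using h
  have hd : DifferentiableOn ℂ (fun w => ∑' n, u n * w ^ n) (Metric.ball 0 c) := by
    refine Complex.differentiableOn_tsum_of_summable_norm hsum (fun n => by fun_prop)
      Metric.isOpen_ball fun n w hw => ?_
    have hw' : ‖w‖ < c := by simpa using hw
    rw [norm_mul, norm_pow]
    gcongr
  have hzc' : Metric.ball (0 : ℂ) c ∈ 𝓝 z := Metric.isOpen_ball.mem_nhds (by simpa using hzc)
  refine ((hd.differentiableAt hzc').congr_of_eventuallyEq ?_).differentiableWithinAt
  filter_upwards [hzc'] with w hw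
  exact (hf w (lt_trans (by simpa using hw) hcρ)).tsum_eq.symm

theorem integral_exp_int_mul_I (m : ℤ) :
    ∫ φ in (-Real.pi)..Real.pi, Complex.exp (m * Complex.I * φ) =
      if m = 0 then 2 * (Real.pi : ℂ) else 0 := by
  split_ifs with hm
  · simp [hm, two_mul]
  · have hm' : (m : ℂ) * Complex.I ≠ 0 := by simp [hm]
    rw [integral_exp_mul_complex hm', div_eq_zero_iff, sub_eq_zero]
    left
    rw [Complex.exp_eq_exp_iff_exists_int]
    exact ⟨m, by push_cast; ring⟩

/-- Cauchy's coefficient formula on a circle inside the disc of convergence. -/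
theorem integral_circle_eq_coeff {u : ℕ → ℂ} {f : ℂ → ℂ} {r : ℝ} (hr : 0 ≤ r)
    (hu : Summable fun n => ‖u n‖ * r ^ n)
    (hf : ∀ z : ℂ, ‖z‖ = r → HasSum (fun n => u n * z ^ n) (f z)) (n : ℕ) :
    ∫ φ in (-Real.pi)..Real.pi,
        f (r * Complex.exp (φ * Complex.I)) * Complex.exp (-(n * φ * Complex.I)) =
      2 * Real.pi * (u n * (r : ℂ) ^ n) := by
  have hnorm : ∀ φ : ℝ, ‖(r : ℂ) * Complex.exp (φ * Complex.I)‖ = r := fun φ => by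
    simp [Complex.norm_exp_ofReal_mul_I, abs_of_nonneg hr]
  have key := intervalIntegral.hasSum_integral_of_dominated_convergence (μ := volume)
    (a := -Real.pi) (b := Real.pi)
    (F := fun (k : ℕ) (φ : ℝ) => u k * (r * Complex.exp (φ * Complex.I)) ^ k *
      Complex.exp (-(n * φ * Complex.I)))
    (f := fun φ : ℝ => f (r * Complex.exp (φ * Complex.I)) * Complex.exp (-(n * φ * Complex.I)))
    (fun k _ => ‖u k‖ * r ^ k)
    (fun k => Continuous.aestronglyMeasurable (by fun_prop))
    (fun k => .of_forall fun φ _ => by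
      rw [norm_mul, norm_mul, norm_pow, hnorm,
        show -((n : ℂ) * φ * Complex.I) = ((-(n * φ) : ℝ) : ℂ) * Complex.I by push_cast; ring,
        Complex.norm_exp_ofReal_mul_I, mul_one])
    (.of_forall fun _ _ => hu) (by simp)
    (.of_forall fun φ _ => (hf _ (hnorm φ)).mul_right _)
  have hterm : ∀ k : ℕ, ∫ φ in (-Real.pi)..Real.pi,
      u k * (r * Complex.exp (φ * Complex.I)) ^ k * Complex.exp (-(n * φ * Complex.I)) =
        if k = n then 2 * Real.pi * (u n * (r : ℂ) ^ n) else 0 := by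
    intro k
    have : ∀ φ : ℝ, u k * (r * Complex.exp (φ * Complex.I)) ^ k *
        Complex.exp (-(n * φ * Complex.I)) =
          u k * (r : ℂ) ^ k * Complex.exp (((k - n : ℤ) : ℂ) * Complex.I * φ) := by
      intro φ
      rw [mul_pow, ← Complex.exp_nat_mul, ← mul_assoc, mul_assoc, ← Complex.exp_add]
      congr 2
      push_cast
      ring
    simp_rw [this]
    rw [intervalIntegral.integral_const_mul, integral_exp_int_mul_I]
    by_cases h : k = n
    · subst h; simp; ring
    · have : (k : ℤ) - n ≠ 0 := by omega
      simp [h, this]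
  simp_rw [hterm] at key
  exact key.unique (hasSum_ite_eq n _)

theorem Complex.norm_exp_sub_one_le_exp_norm_sub_one (z : ℂ) :
    ‖Complex.exp z - 1‖ ≤ Real.exp ‖z‖ - 1 := by
  simpa using Complex.norm_exp_sub_sum_le_exp_norm_sub_sum z 1

/-- Laplace's method: an explicit error bound when the exponent is close to `-c φ² / 2` for
`|φ| ≤ d` and its real part is at most about `-c d² / 2` elsewhere. -/
theorem norm_integral_exp_sub_sqrt_le {h : ℝ → ℂ} (hh : Continuous h) {c d η : ℝ} (hc : 0 < c)
    (hd : 0 < d) (hη : 0 ≤ η) (hdπ : d < Real.pi)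
    (h1 : ∀ φ : ℝ, |φ| ≤ d → ‖h φ + c * φ ^ 2 / 2‖ ≤ η)
    (h2 : ∀ φ : ℝ, d < |φ| → |φ| ≤ Real.pi → (h φ).re ≤ η - c * d ^ 2 / 2) :
    ‖(∫ φ in (-Real.pi)..Real.pi, Complex.exp (h φ)) - (√(2 * Real.pi / c) : ℝ)‖ ≤
      (Real.exp η - 1) * √(2 * Real.pi / c) +
        Real.exp (-(c * d ^ 2 / 4)) * √(4 * Real.pi / c) +
        2 * Real.pi * Real.exp (η - c * d ^ 2 / 2) := by
  have hπ := Real.pi_pos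
  set S : Set ℝ := Set.Ioc (-Real.pi) Real.pi
  have hS : MeasurableSet S := measurableSet_Ioc
  have hI1 : Integrable fun φ : ℝ => Real.exp (-(c / 2) * φ ^ 2) :=
    integrable_exp_neg_mul_sq (by positivity)
  have hI2 : Integrable fun φ : ℝ => Real.exp (-(c / 4) * φ ^ 2) :=
    integrable_exp_neg_mul_sq (by positivity)
  have hI3 : Integrable (S.indicator fun _ => Real.exp (η - c * d ^ 2 / 2)) :=
    (integrable_indicator_iff hS).2 (integrableOn_const (by simp [S]))
  have hI12 : Integrable fun φ : ℝ => (Real.exp η - 1) * Real.exp (-(c / 2) * φ ^ 2) +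
      Real.exp (-(c * d ^ 2 / 4)) * Real.exp (-(c / 4) * φ ^ 2) :=
    (hI1.const_mul _).add (hI2.const_mul _)
  have hIh : Integrable (S.indicator fun φ => Complex.exp (h φ)) :=
    (integrable_indicator_iff hS).2
      ((by fun_prop : Continuous fun φ => Complex.exp (h φ)).integrableOn_Ioc)
  have hv1 : ∫ φ : ℝ, Real.exp (-(c / 2) * φ ^ 2) = √(2 * Real.pi / c) := by
    rw [integral_gaussian]; congr 1; field_simp
  have hv2 : ∫ φ : ℝ, Real.exp (-(c / 4) * φ ^ 2) = √(4 * Real.pi / c) := by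
    rw [integral_gaussian]; congr 1; field_simp
  have hv3 : ∫ φ, S.indicator (fun _ => Real.exp (η - c * d ^ 2 / 2)) φ =
      2 * Real.pi * Real.exp (η - c * d ^ 2 / 2) := by
    rw [integral_indicator hS, setIntegral_const]
    simp [S, hπ.le, two_mul]
  have hlhs : (∫ φ in (-Real.pi)..Real.pi, Complex.exp (h φ)) - (√(2 * Real.pi / c) : ℝ) =
      ∫ φ, (S.indicator (fun φ => Complex.exp (h φ)) φ -
        (Real.exp (-(c / 2) * φ ^ 2) : ℝ)) := by
    have hI1' : Integrable fun φ : ℝ => ((Real.exp (-(c / 2) * φ ^ 2) : ℝ) : ℂ) := hI1.ofReal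
    rw [integral_sub hIh hI1', integral_indicator hS, integral_complex_ofReal, hv1,
      intervalIntegral.integral_of_le (by linarith)]
  have hrhs : (Real.exp η - 1) * √(2 * Real.pi / c) +
        Real.exp (-(c * d ^ 2 / 4)) * √(4 * Real.pi / c) +
        2 * Real.pi * Real.exp (η - c * d ^ 2 / 2) =
      ∫ φ, ((Real.exp η - 1) * Real.exp (-(c / 2) * φ ^ 2) +
        Real.exp (-(c * d ^ 2 / 4)) * Real.exp (-(c / 4) * φ ^ 2) +
        S.indicator (fun _ => Real.exp (η - c * d ^ 2 / 2)) φ) := by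
    rw [integral_add hI12 hI3,
      integral_add (hI1.const_mul _) (hI2.const_mul _), integral_const_mul, integral_const_mul,
      hv1, hv2, hv3]
  rw [hlhs, hrhs]
  have hη1 : 0 ≤ Real.exp η - 1 := by linarith [Real.add_one_le_exp η]
  refine norm_integral_le_of_norm_le (hI12.add hI3) (.of_forall fun φ => ?_)
  have htail : d < |φ| → Real.exp (-(c / 2) * φ ^ 2) ≤
      Real.exp (-(c * d ^ 2 / 4)) * Real.exp (-(c / 4) * φ ^ 2) := fun hφ => by
    rw [← Real.exp_add, Real.exp_le_exp]
    have : d ^ 2 ≤ φ ^ 2 := by rw [← sq_abs φ]; gcongr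
    nlinarith
  have hnn1 : 0 ≤ (Real.exp η - 1) * Real.exp (-(c / 2) * φ ^ 2) := by positivity
  have hnn2 : 0 ≤ Real.exp (-(c * d ^ 2 / 4)) * Real.exp (-(c / 4) * φ ^ 2) := by positivity
  have hgauss : ‖((Real.exp (-(c / 2) * φ ^ 2) : ℝ) : ℂ)‖ = Real.exp (-(c / 2) * φ ^ 2) := by
    rw [Complex.norm_real, Real.norm_of_nonneg (Real.exp_pos _).le]
  by_cases hφS : φ ∈ S
  · rw [Set.indicator_of_mem hφS, Set.indicator_of_mem hφS]
    rcases le_or_gt |φ| d with hφ | hφ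
    · have hfac : Complex.exp (h φ) - ((Real.exp (-(c / 2) * φ ^ 2) : ℝ) : ℂ) =
          ((Real.exp (-(c / 2) * φ ^ 2) : ℝ) : ℂ) * (Complex.exp (h φ + c * φ ^ 2 / 2) - 1) := by
        rw [mul_sub, mul_one, Complex.ofReal_exp, ← Complex.exp_add]
        congr 2
        push_cast
        ring
      have hle := (Complex.norm_exp_sub_one_le_exp_norm_sub_one (h φ + c * φ ^ 2 / 2)).trans
        (sub_le_sub_right (Real.exp_le_exp.2 (h1 φ hφ)) 1)
      rw [hfac, norm_mul, hgauss]
      have := mul_le_mul_of_nonneg_left hle (Real.exp_pos (-(c / 2) * φ ^ 2)).le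
      linarith [Real.exp_pos (η - c * d ^ 2 / 2)]
    · have hre := Real.exp_le_exp.2 (h2 φ hφ (abs_le.2 ⟨hφS.1.le, hφS.2⟩))
      have := norm_sub_le (Complex.exp (h φ)) ((Real.exp (-(c / 2) * φ ^ 2) : ℝ) : ℂ)
      rw [hgauss, Complex.norm_exp] at this
      linarith [htail hφ]
  · have hφ : d < |φ| := by
      refine hdπ.trans_le (not_lt.1 fun hlt => hφS ?_)
      exact ⟨(abs_lt.1 hlt).1, (abs_lt.1 hlt).2.le⟩
    rw [Set.indicator_of_notMem hφS, Set.indicator_of_notMem hφS, zero_sub, norm_neg, hgauss]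
    linarith [htail hφ]

namespace IsLogAdmissible

variable {g : ℂ → ℂ} {gc : ℕ → ℝ} {ρ : ℝ} {a b δ : ℝ → ℝ}

theorem summable_coeff (hadm : IsLogAdmissible g gc ρ a b δ) {t : ℝ} (ht : t ∈ Set.Ico 0 ρ) :
    Summable fun n => gc n * t ^ n := by
  have h := (hadm.series t (by simpa [abs_of_nonneg ht.1] using ht.2)).summable
  exact_mod_cast h

theorem eq_ofReal_tsum (hadm : IsLogAdmissible g gc ρ a b δ) {t : ℝ} (ht : t ∈ Set.Ico 0 ρ) :
    g t = ((∑' k, gc k * t ^ k : ℝ) : ℂ) := by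
  have h := hadm.series t (by simpa [abs_of_nonneg ht.1] using ht.2)
  refine h.unique ?_
  exact_mod_cast (hadm.summable_coeff ht).hasSum

theorem summable_nat_mul_coeff (hadm : IsLogAdmissible g gc ρ a b δ) {c : ℝ}
    (hc : c ∈ Set.Ico 0 ρ) : Summable fun n : ℕ => n * (gc n * c ^ n) := by
  obtain ⟨c', hcc', hc'⟩ := exists_between hc.2
  have hc'0 : 0 < c' := hc.1.trans_lt hcc'
  refine (hadm.summable_coeff ⟨hc'0.le, hc'⟩).of_norm_bounded_eventually_nat ?_
  have hlim := tendsto_self_mul_const_pow_of_lt_one (div_nonneg hc.1 hc'0.le)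
    ((div_lt_one hc'0).2 hcc')
  filter_upwards [hlim.eventually_le_const one_pos] with n hn
  have hg := hadm.coeff_nonneg n
  have hcn := pow_nonneg hc.1 n
  rw [Real.norm_of_nonneg (by positivity)]
  calc (n : ℝ) * (gc n * c ^ n) = gc n * c' ^ n * (n * (c / c') ^ n) := by
        rw [div_pow]; field_simp
    _ ≤ gc n * c' ^ n * 1 := by gcongr
    _ = _ := mul_one _

/-- On a compact subinterval of `[0, ρ)`, `g` is uniformly Lipschitz in the angle at angle `0`. -/
theorem norm_sub_le (hadm : IsLogAdmissible g gc ρ a b δ) {c t : ℝ}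
    (hc : c ∈ Set.Ico 0 ρ) (ht : t ∈ Set.Icc 0 c) (φ : ℝ) :
    ‖g (t * Complex.exp (φ * Complex.I)) - g t‖ ≤ (∑' n : ℕ, n * (gc n * c ^ n)) * |φ| := by
  have htρ : t < ρ := ht.2.trans_lt hc.2
  have h1 := hadm.series (t * Complex.exp (φ * Complex.I)) (by
    simpa [Complex.norm_exp_ofReal_mul_I, abs_of_nonneg ht.1] using htρ)
  have h2 := hadm.series t (by simpa [abs_of_nonneg ht.1] using htρ)
  rw [← (h1.sub h2).tsum_eq, ← tsum_mul_right]
  refine tsum_of_norm_bounded ((hadm.summable_nat_mul_coeff hc).mul_right |φ|).hasSum fun n => ?_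
  have hg := hadm.coeff_nonneg n
  have ht0 := ht.1
  have heq : (gc n : ℂ) * (t * Complex.exp (φ * Complex.I)) ^ n - gc n * (t : ℂ) ^ n =
      ((gc n * t ^ n : ℝ) : ℂ) * (Complex.exp (Complex.I * ((n * φ : ℝ) : ℂ)) - 1) := by
    rw [mul_pow, ← Complex.exp_nat_mul]
    push_cast
    ring_nf
  rw [heq, norm_mul, Complex.norm_real, Real.norm_of_nonneg (by positivity)]
  calc gc n * t ^ n * ‖Complex.exp (Complex.I * ((n * φ : ℝ) : ℂ)) - 1‖
      ≤ gc n * c ^ n * ‖(n * φ : ℝ)‖ := by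
        have := ht.2
        have := hc.1
        have := Real.norm_exp_I_mul_ofReal_sub_one_le (x := n * φ)
        gcongr
    _ = n * (gc n * c ^ n) * |φ| := by
        rw [Real.norm_eq_abs, abs_mul, Nat.abs_cast]; ring

theorem a_le (hadm : IsLogAdmissible g gc ρ a b δ) {c t : ℝ}
    (hc : c ∈ Set.Ico 0 ρ) (ht : t ∈ Set.Icc 0 c) : a t ≤ ∑' n : ℕ, n * (gc n * c ^ n) := by
  obtain ⟨e, -, he⟩ := hadm.approx
  have htρ : t ∈ Set.Ico 0 ρ := ⟨ht.1, ht.2.trans_lt hc.2⟩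
  set C := ∑' n : ℕ, n * (gc n * c ^ n)
  have hlim : Tendsto (fun φ : ℝ => C + e t * φ ^ 2 * (δ t)⁻¹ ^ 3) (𝓝[>] 0) (𝓝 C) := by
    have : Continuous fun φ : ℝ => C + e t * φ ^ 2 * (δ t)⁻¹ ^ 3 := by fun_prop
    simpa using (this.tendsto 0).mono_left nhdsWithin_le_nhds
  refine ge_of_tendsto hlim ?_
  filter_upwards [Ioo_mem_nhdsGT (hadm.delta_pos t htρ)] with φ hφ
  have h1 := he t htρ φ (by rw [abs_of_pos hφ.1]; exact hφ.2.le)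
  have h2 := hadm.norm_sub_le hc ht φ
  rw [abs_of_pos hφ.1] at h1 h2
  have h4 : ‖(φ * Complex.I * a t - (φ : ℂ) ^ 2 / 2 * b t : ℂ)‖ ≤
      C * φ + e t * φ ^ 3 * (δ t)⁻¹ ^ 3 := by
    refine le_trans ?_ (add_le_add h2 h1)
    refine le_trans (le_of_eq ?_) (_root_.norm_sub_le _ _)
    congr 1
    ring
  have h5 := (Complex.abs_im_le_norm _).trans h4
  have h6 : (φ * Complex.I * a t - (φ : ℂ) ^ 2 / 2 * b t : ℂ).im = φ * a t := by
    have : (φ * Complex.I * a t - (φ : ℂ) ^ 2 / 2 * b t : ℂ) =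
        ((-(φ ^ 2 / 2 * b t) : ℝ) : ℂ) + ((φ * a t : ℝ) : ℂ) * Complex.I := by
      push_cast; ring
    rw [this, Complex.add_im, Complex.ofReal_im, Complex.im_ofReal_mul]
    simp
  rw [h6] at h5
  have h7 := (le_abs_self _).trans h5
  have h8 : φ * a t ≤ φ * (C + e t * φ ^ 2 * (δ t)⁻¹ ^ 3) := h7.trans_eq (by ring)
  exact le_of_mul_le_mul_left h8 hφ.1

/-- The coefficients of `exp (l * g)` as integrals over the circle of radius `t`. -/
theorem integral_exp_eq_coeff (hadm : IsLogAdmissible g gc ρ a b δ) {l : ℝ} {u : ℕ → ℝ}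
    (hu : ∀ t ∈ Set.Ico (0 : ℝ) ρ,
      HasSum (fun n => u n * t ^ n) (Real.exp (l * ∑' k : ℕ, gc k * t ^ k)))
    {t : ℝ} (ht : t ∈ Set.Ico 0 ρ) (n : ℕ) :
    ∫ φ in (-Real.pi)..Real.pi, Complex.exp (l * g (t * Complex.exp (φ * Complex.I))) *
        Complex.exp (-(n * φ * Complex.I)) = 2 * Real.pi * (u n * (t : ℂ) ^ n) := by
  have hsum : ∀ r ∈ Set.Ico 0 ρ, Summable fun n => ‖(u n : ℂ)‖ * r ^ n := fun r hr => by
    simpa [abs_mul, abs_of_nonneg hr.1] using (hu r hr).summable.norm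
  have hF : ∀ z : ℂ, ‖z‖ < ρ →
      HasSum (fun n => (u n : ℂ) * z ^ n) (∑' n, (u n : ℂ) * z ^ n) := fun z hz => by
    refine (Summable.of_norm ?_).hasSum
    simpa using hsum ‖z‖ ⟨norm_nonneg z, hz⟩
  have hEq : Set.EqOn (fun z => ∑' n, (u n : ℂ) * z ^ n) (fun z => Complex.exp (l * g z))
      (Metric.ball 0 ρ) := by
    refine AnalyticOnNhd.eqOn_of_preconnected_of_frequently_eq (z₀ := 0)
      ((differentiableOn_of_hasSum_pow hF).analyticOnNhd Metric.isOpen_ball)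
      (((differentiableOn_of_hasSum_pow hadm.series).const_mul (l : ℂ)).cexp.analyticOnNhd
        Metric.isOpen_ball)
      (convex_ball _ _).isPreconnected (Metric.mem_ball_self hadm.rho_pos) ?_
    have htend : Tendsto (fun x : ℝ => (x : ℂ)) (𝓝[>] 0) (𝓝[≠] 0) := by
      refine tendsto_nhdsWithin_iff.2 ⟨?_, ?_⟩
      · simpa using (Complex.continuous_ofReal.tendsto 0).mono_left nhdsWithin_le_nhds
      · filter_upwards [self_mem_nhdsWithin] with x hx
        simpa using (ne_of_gt hx : x ≠ 0)
    refine htend.frequently (Eventually.frequently ?_)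
    filter_upwards [Ioo_mem_nhdsGT hadm.rho_pos] with x hx
    have hx' : x ∈ Set.Ico 0 ρ := ⟨hx.1.le, hx.2⟩
    have h1 := (hu x hx').tsum_eq
    rw [hadm.eq_ofReal_tsum hx', ← Complex.ofReal_mul, ← Complex.ofReal_exp, ← h1]
    push_cast
    rfl
  refine integral_circle_eq_coeff (u := fun n => (u n : ℂ))
    (f := fun z => Complex.exp (l * g z)) ht.1 (hsum t ht) (fun z hz => ?_) n
  have hz' : ‖z‖ < ρ := hz ▸ ht.2
  have hsumF : ∑' n, (u n : ℂ) * z ^ n = Complex.exp (l * g z) := hEq (by simpa using hz')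
  exact hsumF ▸ hF z hz'

theorem continuous_circle (hadm : IsLogAdmissible g gc ρ a b δ) {t : ℝ}
    (ht : t ∈ Set.Ico 0 ρ) :
    Continuous fun φ : ℝ => g (t * Complex.exp (φ * Complex.I)) := by
  refine (differentiableOn_of_hasSum_pow hadm.series).continuousOn.comp_continuous
    (by fun_prop) fun φ => ?_
  simpa [Complex.norm_exp_ofReal_mul_I, abs_of_nonneg ht.1] using ht.2

/-- Saddle point estimate for the coefficients of `exp (l * g)` at a fixed radius `t`. -/
theorem abs_coeff_sub_le (hadm : IsLogAdmissible g gc ρ a b δ) {e : ℝ → ℝ}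
    (he : ∀ r ∈ Set.Ico (0 : ℝ) ρ, ∀ φ : ℝ, |φ| ≤ δ r →
      ‖g (r * Complex.exp (φ * Complex.I)) -
          (g r + φ * Complex.I * a r - (φ : ℂ) ^ 2 / 2 * b r)‖ ≤
        e r * |φ| ^ 3 * (δ r)⁻¹ ^ 3)
    {l : ℝ} (hl : 0 < l) {u : ℕ → ℝ}
    (hu : ∀ t ∈ Set.Ico (0 : ℝ) ρ,
      HasSum (fun n => u n * t ^ n) (Real.exp (l * ∑' k : ℕ, gc k * t ^ k)))
    {t : ℝ} (ht : t ∈ Set.Ico 0 ρ) {n : ℕ} (hn : l * a t = n) (hb : 0 < b t)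
    (hδ : δ t < Real.pi) {η : ℝ} (hη : l * |e t| ≤ η) :
    |2 * Real.pi * (u n * t ^ n) * Real.exp (-(l * ∑' k : ℕ, gc k * t ^ k)) -
        √(2 * Real.pi / (l * b t))| ≤
      (Real.exp η - 1) * √(2 * Real.pi / (l * b t)) +
        Real.exp (-(l * b t * δ t ^ 2 / 4)) * √(4 * Real.pi / (l * b t)) +
        2 * Real.pi * Real.exp (η - l * b t * δ t ^ 2 / 2) := by
  have hδ0 := hadm.delta_pos t ht
  have hgt := hadm.eq_ofReal_tsum ht
  set S := ∑' k : ℕ, gc k * t ^ k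
  have hnC : (n : ℂ) = l * a t := by exact_mod_cast hn.symm
  have happ : ∀ φ : ℝ, |φ| ≤ δ t → ‖g (t * Complex.exp (φ * Complex.I)) -
      (g t + φ * Complex.I * a t - (φ : ℂ) ^ 2 / 2 * b t)‖ ≤ |e t| := fun φ hφ => by
    refine (he t ht φ hφ).trans ?_
    have h1 : |φ| * (δ t)⁻¹ ≤ 1 := by rw [← div_eq_mul_inv]; exact (div_le_one hδ0).2 hφ
    calc e t * |φ| ^ 3 * (δ t)⁻¹ ^ 3 = e t * (|φ| * (δ t)⁻¹) ^ 3 := by ring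
      _ ≤ |e t| * (|φ| * (δ t)⁻¹) ^ 3 := by gcongr; exact le_abs_self _
      _ ≤ |e t| * 1 := by gcongr; exact pow_le_one₀ (by positivity) h1
      _ = |e t| := mul_one _
  have happ_re : ∀ φ : ℝ, |φ| ≤ δ t →
      (g (t * Complex.exp (φ * Complex.I))).re ≤ S - φ ^ 2 / 2 * b t + |e t| := fun φ hφ => by
    have h := (Complex.re_le_norm _).trans (happ φ hφ)
    have h2 : (g t + φ * Complex.I * a t - (φ : ℂ) ^ 2 / 2 * b t : ℂ) =
        ((S - φ ^ 2 / 2 * b t : ℝ) : ℂ) + ((φ * a t : ℝ) : ℂ) * Complex.I := by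
      rw [hgt]; push_cast; ring
    rw [h2, Complex.sub_re, Complex.add_re, Complex.ofReal_re, Complex.re_ofReal_mul,
      Complex.I_re, mul_zero, add_zero] at h
    linarith
  have hmain := norm_integral_exp_sub_sqrt_le
    (h := fun φ : ℝ => l * (g (t * Complex.exp (φ * Complex.I)) - g t) - n * φ * Complex.I)
    (c := l * b t) (d := δ t) (η := η)
    ((continuous_const.mul ((hadm.continuous_circle ht).sub continuous_const)).sub
      (by fun_prop)) (by positivity) hδ0
    (le_trans (by positivity) hη) hδ ?_ ?_
  · have hint : (∫ φ in (-Real.pi)..Real.pi, Complex.exp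
        (l * (g (t * Complex.exp (φ * Complex.I)) - g t) - n * φ * Complex.I)) =
          ((2 * Real.pi * (u n * t ^ n) * Real.exp (-(l * S)) : ℝ) : ℂ) := by
      have h := hadm.integral_exp_eq_coeff hu ht n
      have hexp : ∀ φ : ℝ, Complex.exp
          (l * (g (t * Complex.exp (φ * Complex.I)) - g t) - n * φ * Complex.I) =
            Complex.exp (l * g (t * Complex.exp (φ * Complex.I))) *
              Complex.exp (-(n * φ * Complex.I)) * Complex.exp (-(l * S : ℝ)) := fun φ => by
        rw [← Complex.exp_add, ← Complex.exp_add, hgt]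
        congr 1
        push_cast
        ring
      simp_rw [hexp]
      rw [intervalIntegral.integral_mul_const, h]
      push_cast
      rfl
    rw [hint, ← Complex.ofReal_sub, Complex.norm_real, Real.norm_eq_abs] at hmain
    exact hmain
  · intro φ hφ
    have heq : l * (g (t * Complex.exp (φ * Complex.I)) - g t) - n * φ * Complex.I +
        ((l * b t : ℝ) : ℂ) * φ ^ 2 / 2 = l * (g (t * Complex.exp (φ * Complex.I)) -
          (g t + φ * Complex.I * a t - (φ : ℂ) ^ 2 / 2 * b t)) := by
      rw [hnC]; push_cast; ring
    rw [heq, norm_mul, Complex.norm_real, Real.norm_of_nonneg hl.le]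
    exact (mul_le_mul_of_nonneg_left (happ φ hφ) hl.le).trans hη
  · intro φ h1 h2
    have hre : (l * (g (t * Complex.exp (φ * Complex.I)) - g t) - n * φ * Complex.I : ℂ).re =
        l * ((g (t * Complex.exp (φ * Complex.I))).re - S) := by
      rw [show (n * φ * Complex.I : ℂ) = ((n * φ : ℝ) : ℂ) * Complex.I by push_cast; rfl,
        Complex.sub_re, Complex.re_ofReal_mul, Complex.re_ofReal_mul, hgt]
      simp
    have hp := happ_re (δ t) (abs_of_pos hδ0).le
    have hm := happ_re (-δ t) (by rw [abs_neg, abs_of_pos hδ0])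
    rw [Complex.ofReal_neg, neg_sq] at hm
    have hmax := (hadm.mono t ht φ h1 h2).trans (max_le hp hm)
    rw [hre]
    have := mul_le_mul_of_nonneg_left hmax hl.le
    nlinarith

/-- The relative error in the saddle point estimate is small near the radius of convergence. -/
theorem tendsto_error (hadm : IsLogAdmissible g gc ρ a b δ) {e : ℝ → ℝ}
    (he : Tendsto e (𝓝[<] ρ) (𝓝 0)) {m : ℝ} (hm : 0 < m) (L : ℝ) :
    Tendsto (fun t => (Real.exp (L * |e t|) - 1) + Real.exp (-(m * b t * δ t ^ 2 / 4)) * √2 +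
      √(2 * Real.pi * (L * b t)) * Real.exp (L * |e t| - m * b t * δ t ^ 2 / 2))
      (𝓝[<] ρ) (𝓝 0) := by
  have hLe : Tendsto (fun t => L * |e t|) (𝓝[<] ρ) (𝓝 0) := by simpa using he.abs.const_mul L
  have hexp : Tendsto (fun t => Real.exp (L * |e t|)) (𝓝[<] ρ) (𝓝 1) := by
    simpa [Function.comp_def] using (Real.continuous_exp.tendsto 0).comp hLe
  have hw := hadm.width m hm
  have hmb : Tendsto (fun t => m * b t * δ t ^ 2) (𝓝[<] ρ) atTop := by
    refine (hw.atTop_add_atTop (Real.tendsto_log_atTop.comp hadm.b_div)).congr fun t => ?_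
    simp only [Function.comp]
    ring
  have h2 : Tendsto (fun t => Real.exp (-(m * b t * δ t ^ 2 / 4)) * √2) (𝓝[<] ρ) (𝓝 0) := by
    simpa using (Real.tendsto_exp_neg_atTop_nhds_zero.comp
      (hmb.atTop_div_const (by norm_num : (0 : ℝ) < 4))).mul_const √2
  have h3 : Tendsto (fun t => √(2 * Real.pi * L) * (Real.exp (L * |e t|) *
      Real.exp (-((m * δ t ^ 2 * b t - Real.log (b t)) / 2)))) (𝓝[<] ρ) (𝓝 0) := by
    simpa using (hexp.mul (Real.tendsto_exp_neg_atTop_nhds_zero.comp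
      (hw.atTop_div_const two_pos))).const_mul √(2 * Real.pi * L)
  have h3' : Tendsto (fun t => √(2 * Real.pi * (L * b t)) *
      Real.exp (L * |e t| - m * b t * δ t ^ 2 / 2)) (𝓝[<] ρ) (𝓝 0) := by
    refine h3.congr' ?_
    filter_upwards [hadm.b_div.eventually_gt_atTop 0] with t ht
    have hs : √(b t) = Real.exp (Real.log (b t) / 2) := by
      rw [Real.sqrt_eq_rpow, Real.rpow_def_of_pos ht]; ring_nf
    rw [← mul_assoc (2 * Real.pi), Real.sqrt_mul' _ ht.le, hs, mul_assoc √_, ← Real.exp_add,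
      ← Real.exp_add]
    congr 2
    ring
  simpa using ((hexp.sub_const 1).add h2).add h3'

end IsLogAdmissible

/-- **Proposition 2.2.** Let `s ∈ ℝ`, `g` log-admissible with associated
functions `a`, `b`, and `r_x` the unique solution of `a(r) = x`. Define
`G_{n,s}` by `Σ_n G_{n,s} t^n = exp(e^{-s} g(t))`. Then
`G_{n,s} = (2π)^{-1/2} e^{s/2} r_{e^s n}^{-n} b(r_{e^s n})^{-1/2}
exp(e^{-s} g(r_{e^s n})) (1 + o(1))` as `n → ∞`, uniformly in `s` for `s` in a
fixed compact set. -/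
theorem asymptotic_Gns
    (g : ℂ → ℂ) (gc : ℕ → ℝ) (ρ : ℝ) (a b δ : ℝ → ℝ)
    (hadm : IsLogAdmissible g gc ρ a b δ)
    (r : ℝ → ℝ) (hr : ∀ x > 0, r x ∈ Set.Ico 0 ρ ∧ a (r x) = x)
    (hru : ∀ x > 0, ∀ y ∈ Set.Ico (0 : ℝ) ρ, a y = x → y = r x)
    (G : ℝ → ℕ → ℝ)
    (hG : ∀ s : ℝ, ∀ t ∈ Set.Ico (0 : ℝ) ρ,
      HasSum (fun n => G s n * t ^ n)
        (Real.exp (Real.exp (-s) * ∑' k : ℕ, gc k * t ^ k))) :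
    ∀ M > 0, ∀ ε > 0, ∃ N : ℕ, ∀ n ≥ N, ∀ s : ℝ, |s| ≤ M →
      |G s n -
          Real.exp (s / 2) *
              Real.exp (Real.exp (-s) * ∑' k : ℕ, gc k * r (Real.exp s * n) ^ k) /
            (Real.sqrt (2 * Real.pi) * r (Real.exp s * n) ^ n *
              Real.sqrt (b (r (Real.exp s * n))))| ≤
        ε * |Real.exp (s / 2) *
              Real.exp (Real.exp (-s) * ∑' k : ℕ, gc k * r (Real.exp s * n) ^ k) /
            (Real.sqrt (2 * Real.pi) * r (Real.exp s * n) ^ n *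
              Real.sqrt (b (r (Real.exp s * n))))| := by
  intro M _ ε hε
  obtain ⟨e, he0, he⟩ := hadm.approx
  have hev := (((hadm.tendsto_error he0 (Real.exp_pos (-M)) (Real.exp M)).eventually_le_const
    hε).and (hadm.b_div.eventually_gt_atTop 0)).and
      (hadm.delta_lim.eventually_lt_const Real.pi_pos)
  obtain ⟨c₀, hc₀, hsub⟩ := mem_nhdsLT_iff_exists_Ioo_subset.1 hev
  set c := max c₀ 0
  have hc : c ∈ Set.Ico 0 ρ := ⟨le_max_right _ _, max_lt hc₀ hadm.rho_pos⟩
  set C := ∑' n : ℕ, n * (gc n * c ^ n)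
  refine ⟨⌊Real.exp M * |C|⌋₊ + 1, fun n hn s hs => ?_⟩
  obtain ⟨hs1, hs2⟩ := abs_le.1 hs
  have hnC : Real.exp M * |C| < n := (Nat.lt_floor_add_one _).trans_le (by exact_mod_cast hn)
  set x := Real.exp s * n with hx
  have hCx : |C| < x := by
    calc |C| = Real.exp (-M) * (Real.exp M * |C|) := by
          rw [← mul_assoc, ← Real.exp_add]; simp
      _ < Real.exp (-M) * n := by gcongr
      _ ≤ x := by rw [hx]; gcongr
  obtain ⟨ht, hax⟩ := hr x ((abs_nonneg C).trans_lt hCx)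
  set t := r x
  have hct : c < t := by
    by_contra! h
    have := hadm.a_le hc ⟨ht.1, h⟩
    linarith [le_abs_self C]
  have ht0 : 0 < t := hc.1.trans_lt hct
  obtain ⟨⟨hE, hb⟩, hδ⟩ := hsub ⟨(le_max_left _ _).trans_lt hct, ht.2⟩
  have hl1 : Real.exp (-M) ≤ Real.exp (-s) := Real.exp_le_exp.2 (by linarith)
  have hl2 : Real.exp (-s) ≤ Real.exp M := Real.exp_le_exp.2 (by linarith)
  have hl : 0 < Real.exp (-s) := Real.exp_pos _
  have hn' : Real.exp (-s) * a t = n := by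
    rw [hax, hx, ← mul_assoc, ← Real.exp_add]; simp
  have hmain := hadm.abs_coeff_sub_le he hl (hG s) ht hn' hb hδ
    (η := Real.exp M * |e t|) (by gcongr)
  set S := ∑' k : ℕ, gc k * t ^ k
  set T := Real.exp (s / 2) * Real.exp (Real.exp (-s) * S) /
    (√(2 * Real.pi) * t ^ n * √(b t)) with hT
  have hπ := Real.pi_pos
  have hT0 : 0 < T := by positivity
  have hTeq : √(2 * Real.pi / (Real.exp (-s) * b t)) =
      2 * Real.pi * t ^ n * Real.exp (-(Real.exp (-s) * S)) * T := by
    have h1 : √(Real.exp (-s)) = (Real.exp (s / 2))⁻¹ := by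
      rw [← Real.exp_neg, Real.sqrt_eq_iff_mul_self_eq_of_pos (Real.exp_pos _), ← Real.exp_add]
      ring_nf
    have h2 : √(2 * Real.pi) * √(2 * Real.pi) = 2 * Real.pi :=
      Real.mul_self_sqrt (by positivity)
    rw [Real.sqrt_div (by positivity), Real.sqrt_mul hl.le, h1, hT, Real.exp_neg (_ * S)]
    field_simp
    rw [sq, h2]
  have hB : (Real.exp (Real.exp M * |e t|) - 1) * √(2 * Real.pi / (Real.exp (-s) * b t)) +
      Real.exp (-(Real.exp (-s) * b t * δ t ^ 2 / 4)) *
        √(4 * Real.pi / (Real.exp (-s) * b t)) +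
      2 * Real.pi * Real.exp (Real.exp M * |e t| - Real.exp (-s) * b t * δ t ^ 2 / 2) ≤
        ε * √(2 * Real.pi / (Real.exp (-s) * b t)) := by
    have h4 : √(4 * Real.pi / (Real.exp (-s) * b t)) =
        √2 * √(2 * Real.pi / (Real.exp (-s) * b t)) := by
      rw [← Real.sqrt_mul zero_le_two]; ring_nf
    have h2 : 2 * Real.pi = √(2 * Real.pi * (Real.exp (-s) * b t)) *
        √(2 * Real.pi / (Real.exp (-s) * b t)) := by
      rw [← Real.sqrt_mul (by positivity), eq_comm, Real.sqrt_eq_iff_mul_self_eq_of_pos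
        (by positivity)]
      field_simp
    calc
      _ = ((Real.exp (Real.exp M * |e t|) - 1) +
            Real.exp (-(Real.exp (-s) * b t * δ t ^ 2 / 4)) * √2 +
            √(2 * Real.pi * (Real.exp (-s) * b t)) *
              Real.exp (Real.exp M * |e t| - Real.exp (-s) * b t * δ t ^ 2 / 2)) *
          √(2 * Real.pi / (Real.exp (-s) * b t)) := by
        rw [h4]
        linear_combination
          Real.exp (Real.exp M * |e t| - Real.exp (-s) * b t * δ t ^ 2 / 2) * h2
      _ ≤ ((Real.exp (Real.exp M * |e t|) - 1) +
            Real.exp (-(Real.exp (-M) * b t * δ t ^ 2 / 4)) * √2 +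
            √(2 * Real.pi * (Real.exp M * b t)) *
              Real.exp (Real.exp M * |e t| - Real.exp (-M) * b t * δ t ^ 2 / 2)) *
          √(2 * Real.pi / (Real.exp (-s) * b t)) := by gcongr
      _ ≤ _ := by gcongr
  have hfac : 2 * Real.pi * (G s n * t ^ n) * Real.exp (-(Real.exp (-s) * S)) -
      √(2 * Real.pi / (Real.exp (-s) * b t)) =
        2 * Real.pi * t ^ n * Real.exp (-(Real.exp (-s) * S)) * (G s n - T) := by
    rw [hTeq]; ring
  have hpos : 0 < 2 * Real.pi * t ^ n * Real.exp (-(Real.exp (-s) * S)) := by positivity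
  have hfin := hmain.trans hB
  rw [hfac, abs_mul, abs_of_pos hpos, hTeq, mul_left_comm] at hfin
  rw [abs_of_pos hT0]
  exact le_of_mul_le_mul_left hfin hpos
end
end

section
/- Let the weights be θ_k = k, so that g_θ(t) = (1 − t)^{−1}. Then the normalization constant of the generalized Ewens measure satisfies h_n = (4π)^{−1/2} n^{−3/4} exp(2√n (1 + o(1))) as n → ∞. -/
open Filter Set Asymptotics MeasureTheory
open scoped Topology

noncomputable section

/-- `c_j(σ)`: the number of cycles of length `j` in the permutation `σ ∈ S_n`
(fixed points count as cycles of length 1). -/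
def cycleCount (n j : ℕ) (σ : Equiv.Perm (Fin n)) : ℕ :=
  if j = 1 then n - σ.support.card else σ.cycleType.count j

/-- `K_{0n}(σ) = Σ_{j=1}^n c_j(σ)`: the total number of cycles of `σ`. -/
def numCycles (n : ℕ) (σ : Equiv.Perm (Fin n)) : ℕ :=
  (n - σ.support.card) + σ.cycleType.card

/-- The unnormalized generalized Ewens weight `∏_{j=1}^n θ_j^{c_j(σ)}`. -/
def ewensWeight (θ : ℕ → ℝ) (n : ℕ) (σ : Equiv.Perm (Fin n)) : ℝ :=
  ∏ j ∈ Finset.Icc 1 n, θ j ^ cycleCount n j σ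

/-- The normalization constant `h_n = (1/n!) Σ_σ ∏_j θ_j^{c_j(σ)}` of the
generalized Ewens measure (equivalently, the `n`-th coefficient of `exp g_θ`). -/
def ewensH (θ : ℕ → ℝ) (n : ℕ) : ℝ :=
  (n.factorial : ℝ)⁻¹ * ∑ σ : Equiv.Perm (Fin n), ewensWeight θ n σ

open scoped Classical in
/-- Probability of an event under the generalized Ewens measure
`ℙ(σ) = (1/(h_n n!)) ∏_j θ_j^{c_j(σ)}`. -/
def ewensProb (θ : ℕ → ℝ) (n : ℕ) (p : Equiv.Perm (Fin n) → Prop) : ℝ :=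
  (∑ σ ∈ Finset.univ.filter p, ewensWeight θ n σ) /
    ∑ σ : Equiv.Perm (Fin n), ewensWeight θ n σ

/-- Expectation under the generalized Ewens measure. -/
def ewensExpect (θ : ℕ → ℝ) (n : ℕ) (f : Equiv.Perm (Fin n) → ℝ) : ℝ :=
  (∑ σ : Equiv.Perm (Fin n), f σ * ewensWeight θ n σ) /
    ∑ σ : Equiv.Perm (Fin n), ewensWeight θ n σ

/-- The coefficient sequence of `g_θ(t) = Σ_{k≥1} (θ_k/k) t^k`. -/
def thetaCoeff (θ : ℕ → ℝ) : ℕ → ℝ := fun k => if k = 0 then 0 else θ k / k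

/-- `g_θ` as a function on the complex disc. -/
def gThetaC (θ : ℕ → ℝ) : ℂ → ℂ := fun z => ∑' k : ℕ, (thetaCoeff θ k : ℂ) * z ^ k

/-- `g_θ` as a real function. -/
def gThetaR (θ : ℕ → ℝ) : ℝ → ℝ := fun t => ∑' k : ℕ, thetaCoeff θ k * t ^ k

/-- The standard normal cumulative distribution function. -/
def stdNormalCDF (x : ℝ) : ℝ :=
  ∫ t in Set.Iic x, Real.exp (-t ^ 2 / 2) / Real.sqrt (2 * Real.pi)

/-- `(K_{0n} - μ_n)/σ_n` converges in distribution to a standard normal random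
variable, where `K_{0n}` is distributed according to the generalized Ewens
measure with weights `θ` (stated via pointwise convergence of the CDFs to the
continuous standard normal CDF). -/
def convergesToStdNormal (θ : ℕ → ℝ) (μ σ' : ℕ → ℝ) : Prop :=
  ∀ x : ℝ, Tendsto
    (fun n => ewensProb θ n fun σ => ((numCycles n σ : ℝ) - μ n) / σ' n ≤ x)
    atTop (𝓝 (stdNormalCDF x))

/-- The partition of `n` given by the cycle lengths of `σ ∈ S_n`, fixed points included. -/
def cyclePartition {n : ℕ} (σ : Equiv.Perm (Fin n)) : n.Partition where
  parts := σ.partition.parts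
  parts_pos := σ.partition.parts_pos
  parts_sum := by simpa using σ.partition.parts_sum

lemma cyclePartition_eq_iff {n : ℕ} (σ : Equiv.Perm (Fin n)) (p : n.Partition) :
    cyclePartition σ = p ↔ σ.cycleType = p.parts.filter (2 ≤ ·) := by
  constructor
  · rintro rfl
    exact Equiv.Perm.filter_parts_partition_eq_cycleType.symm
  · intro h
    have hp : p.parts.filter (fun a => ¬ 2 ≤ a) =
        Multiset.replicate (p.parts.filter (fun a => ¬ 2 ≤ a)).card 1 := by
      rw [Multiset.eq_replicate]
      refine ⟨rfl, fun b hb => ?_⟩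
      rw [Multiset.mem_filter] at hb
      have := p.parts_pos hb.1
      omega
    have hadd := Multiset.filter_add_not (fun a => 2 ≤ a) p.parts
    have hsum := p.parts_sum
    rw [← hadd, Multiset.sum_add, hp, ← h, Equiv.Perm.sum_cycleType] at hsum
    simp only [Multiset.sum_replicate, smul_eq_mul, mul_one] at hsum
    ext1
    change σ.partition.parts = p.parts
    rw [Equiv.Perm.parts_partition, ← hadd, hp, ← h, Fintype.card_fin]
    congr 2
    omega

lemma ewensWeight_natCast {n : ℕ} (σ : Equiv.Perm (Fin n)) :
    ewensWeight (fun k => (k : ℝ)) n σ = (σ.cycleType.prod : ℝ) := by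
  have hsub : σ.cycleType.toFinset ⊆ Finset.Icc 1 n := by
    intro j hj
    rw [Multiset.mem_toFinset] at hj
    have h2 := Equiv.Perm.two_le_of_mem_cycleType hj
    have h3 := Equiv.Perm.le_card_support_of_mem_cycleType hj
    have h4 := σ.support.card_le_univ
    rw [Fintype.card_fin] at h4
    rw [Finset.mem_Icc]
    omega
  rw [Finset.prod_multiset_count_of_subset _ _ hsub]
  push_cast
  refine Finset.prod_congr rfl fun j _ => ?_
  unfold cycleCount
  split_ifs with h
  · simp [h]
  · rfl

lemma card_cyclePartition_mul {n : ℕ} (p : n.Partition) :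
    (Finset.univ.filter fun σ : Equiv.Perm (Fin n) => cyclePartition σ = p).card *
      ((p.parts.filter (2 ≤ ·)).prod * ∏ j ∈ p.parts.toFinset, (p.parts.count j).factorial) =
      n.factorial := by
  set m := p.parts.filter (2 ≤ ·) with hm
  have hp : p.parts.filter (fun a => ¬ 2 ≤ a) = Multiset.replicate (p.parts.count 1) 1 := by
    rw [← Multiset.filter_eq']
    refine Multiset.filter_congr fun a ha => ?_
    have := p.parts_pos ha
    omega
  have hadd := Multiset.filter_add_not (fun a => 2 ≤ a) p.parts
  rw [hp, ← hm] at hadd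
  have hsum := p.parts_sum
  rw [← hadd, Multiset.sum_add] at hsum
  simp only [Multiset.sum_replicate, smul_eq_mul, mul_one] at hsum
  have key := Equiv.Perm.card_of_cycleType_mul_eq (Fin n) m
  rw [if_pos ⟨by rw [Fintype.card_fin]; omega, by simp [hm]⟩, Fintype.card_fin] at key
  simp_rw [cyclePartition_eq_iff]
  have h1 : n - m.sum = p.parts.count 1 := by omega
  have hprod : ∏ j ∈ m.toFinset, (m.count j).factorial =
      ∏ j ∈ p.parts.toFinset.erase 1, (p.parts.count j).factorial := by
    have : m.toFinset = p.parts.toFinset.erase 1 := by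
      ext j
      simp only [hm, Multiset.mem_toFinset, Multiset.mem_filter, Finset.mem_erase]
      constructor
      · rintro ⟨h, h'⟩
        exact ⟨by omega, h⟩
      · rintro ⟨h, h'⟩
        have := p.parts_pos h'
        exact ⟨h', by omega⟩
    rw [this]
    refine Finset.prod_congr rfl fun j hj => ?_
    rw [← this, Multiset.mem_toFinset, Multiset.mem_filter] at hj
    rw [hm, Multiset.count_filter_of_pos hj.2]
  have heq : (n - m.sum).factorial * ∏ j ∈ m.toFinset, (m.count j).factorial =
      ∏ j ∈ p.parts.toFinset, (p.parts.count j).factorial := by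
    rw [h1, hprod]
    by_cases h : 1 ∈ p.parts.toFinset
    · rw [Finset.mul_prod_erase _ (fun j => (p.parts.count j).factorial) h]
    · rw [Finset.erase_eq_of_notMem h, Multiset.count_eq_zero_of_notMem (by simpa using h)]
      simp
  rw [← hm, ← key, ← heq]
  ring

lemma ewensH_natCast_eq_sum_partition (n : ℕ) :
    ewensH (fun k => (k : ℝ)) n =
      ∑ p : n.Partition, (∏ j ∈ p.parts.toFinset, ((p.parts.count j).factorial : ℝ))⁻¹ := by
  unfold ewensH
  rw [← Finset.sum_fiberwise (s := Finset.univ) (g := fun σ : Equiv.Perm (Fin n) =>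
    cyclePartition σ), Finset.mul_sum]
  refine Finset.sum_congr rfl fun p _ => ?_
  have h : ∀ σ ∈ Finset.univ.filter fun σ : Equiv.Perm (Fin n) => cyclePartition σ = p,
      ewensWeight (fun k => (k : ℝ)) n σ = ((p.parts.filter (2 ≤ ·)).prod : ℝ) := by
    intro σ hσ
    rw [ewensWeight_natCast, (cyclePartition_eq_iff σ p).1 (Finset.mem_filter.1 hσ).2]
  rw [Finset.sum_congr rfl h, Finset.sum_const, nsmul_eq_mul]
  have key := card_cyclePartition_mul p
  have hn : (n.factorial : ℝ) ≠ 0 := by positivity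
  have hq : (∏ j ∈ p.parts.toFinset, ((p.parts.count j).factorial : ℝ)) ≠ 0 := by positivity
  have key' := congrArg (Nat.cast : ℕ → ℝ) key
  push_cast at key' ⊢
  field_simp
  linarith

open Polynomial in
/-- The generating polynomial `∑_{j=1}^n X^j` of the positive integers up to `n`. -/
def posPoly (n : ℕ) : Polynomial ℝ := ∑ j ∈ Finset.Icc 1 n, X ^ j

lemma coeff_posPoly_pow (n k : ℕ) :
    (posPoly n ^ k).coeff n / k.factorial =
      ∑ p : n.Partition with p.parts.card = k,
        (∏ j ∈ p.parts.toFinset, ((p.parts.count j).factorial : ℝ))⁻¹ := by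
  unfold posPoly
  rw [Finset.sum_pow, Polynomial.finsetSum_coeff, Finset.sum_div]
  symm
  have hprod : ∀ m : Multiset ℕ,
      (m.map fun j => (Polynomial.X : Polynomial ℝ) ^ j).prod = Polynomial.X ^ m.sum := by
    intro m
    induction m using Multiset.induction_on with
    | empty => simp
    | cons a m ih => simp [ih, pow_add]
  have hcoeff : ∀ m : Multiset ℕ, (((m.countPerms : ℕ) : Polynomial ℝ) *
      (m.map fun j => (Polynomial.X : Polynomial ℝ) ^ j).prod).coeff n =
        if m.sum = n then (m.countPerms : ℝ) else 0 := by
    intro m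
    rw [hprod, Polynomial.coeff_natCast_mul, Polynomial.coeff_X_pow, mul_ite, mul_one, mul_zero]
    simp [eq_comm (a := n)]
  simp_rw [hcoeff]
  have hcount : ∀ m : Multiset ℕ, m.card = k → (m.countPerms : ℝ) / k.factorial =
      (∏ j ∈ m.toFinset, ((m.count j).factorial : ℝ))⁻¹ := by
    rintro m rfl
    have h := Nat.multinomial_spec m.toFinset (fun j => m.count j)
    have h2 : m.countPerms = Nat.multinomial m.toFinset (fun j => m.count j) := by
      unfold Multiset.countPerms
      rw [Finsupp.multinomial_eq]
      rfl
    rw [Multiset.toFinset_sum_count_eq, ← h2] at h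
    have h' := congrArg (Nat.cast : ℕ → ℝ) h
    push_cast at h'
    have hq : (∏ j ∈ m.toFinset, ((m.count j).factorial : ℝ)) ≠ 0 := by positivity
    rw [← h']
    have : (m.countPerms : ℝ) ≠ 0 := by
      intro h0
      rw [h0, mul_zero] at h'
      exact Nat.cast_ne_zero.2 m.card.factorial_ne_zero h'.symm
    field_simp
  simp_rw [ite_div, zero_div]
  rw [← Finset.sum_filter]
  refine Finset.sum_bij (fun p hp => (⟨p.parts, (Finset.mem_filter.1 hp).2⟩ : Sym ℕ k)) ?_ ?_ ?_ ?_
  · intro p hp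
    refine Finset.mem_filter.2 ⟨Finset.mem_sym_iff.2 fun a ha => ?_, p.parts_sum⟩
    have ha : a ∈ p.parts := ha
    rw [Finset.mem_Icc]
    exact ⟨p.parts_pos ha, (Multiset.le_sum_of_mem ha).trans_eq p.parts_sum⟩
  · intro p _ q _ h
    ext1
    exact congrArg Subtype.val h
  · intro s hs
    rw [Finset.mem_filter, Finset.mem_sym_iff] at hs
    exact ⟨⟨s.val, fun hi => (Finset.mem_Icc.1 (hs.1 _ hi)).1, hs.2⟩, by simp, rfl⟩
  · intro p hp
    exact (hcount _ (Finset.mem_filter.1 hp).2).symm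

lemma ewensH_natCast_eq_sum_coeff (n : ℕ) :
    ewensH (fun k => (k : ℝ)) n =
      ∑ k ∈ Finset.range (n + 1), (posPoly n ^ k).coeff n / k.factorial := by
  simp_rw [coeff_posPoly_pow]
  rw [ewensH_natCast_eq_sum_partition, Finset.sum_fiberwise_of_maps_to]
  intro p _
  rw [Finset.mem_range, Nat.lt_succ_iff]
  have h := Multiset.card_nsmul_le_sum (s := p.parts) (a := 1) fun x hx => p.parts_pos hx
  simpa [p.parts_sum] using h

lemma posPoly_pow_coeff_nonneg (n k i : ℕ) : 0 ≤ (posPoly n ^ k).coeff i := by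
  induction k generalizing i with
  | zero =>
    rw [pow_zero, Polynomial.coeff_one]
    split_ifs <;> norm_num
  | succ k ih =>
    rw [pow_succ, Polynomial.coeff_mul]
    refine Finset.sum_nonneg fun a _ => mul_nonneg (ih _) ?_
    rw [posPoly, Polynomial.finsetSum_coeff]
    refine Finset.sum_nonneg fun j _ => ?_
    rw [Polynomial.coeff_X_pow]
    split_ifs <;> norm_num

lemma coeff_mul_pow_le_eval {p : Polynomial ℝ} (hp : ∀ i, 0 ≤ p.coeff i) {x : ℝ} (hx : 0 ≤ x)
    (n : ℕ) : p.coeff n * x ^ n ≤ p.eval x := by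
  rcases le_or_gt n p.natDegree with h | h
  · rw [Polynomial.eval_eq_sum_range]
    exact Finset.single_le_sum (f := fun i => p.coeff i * x ^ i)
      (fun i _ => mul_nonneg (hp i) (pow_nonneg hx i)) (Finset.mem_range.2 (by omega))
  · rw [Polynomial.coeff_eq_zero_of_natDegree_lt h, zero_mul, Polynomial.eval_eq_sum_range]
    exact Finset.sum_nonneg fun i _ => mul_nonneg (hp i) (pow_nonneg hx i)

lemma ewensH_natCast_mul_pow_le (n : ℕ) {x : ℝ} (hx : 0 ≤ x) :
    ewensH (fun k => (k : ℝ)) n * x ^ n ≤ Real.exp ((posPoly n).eval x) := by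
  have hy : 0 ≤ (posPoly n).eval x := by
    rw [posPoly, Polynomial.eval_finsetSum]
    exact Finset.sum_nonneg fun j _ => by simpa using pow_nonneg hx j
  refine le_trans ?_ (Real.sum_le_exp_of_nonneg hy (n + 1))
  rw [ewensH_natCast_eq_sum_coeff, Finset.sum_mul]
  refine Finset.sum_le_sum fun k _ => ?_
  rw [div_mul_eq_mul_div, ← Polynomial.eval_pow]
  gcongr
  exact coeff_mul_pow_le_eval (posPoly_pow_coeff_nonneg n k) hx n

lemma eval_posPoly_mul (n : ℕ) (x : ℝ) :
    (posPoly n).eval x * (1 - x) = x - x ^ (n + 1) := by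
  simp only [posPoly, Polynomial.eval_finsetSum, Polynomial.eval_pow, Polynomial.eval_X]
  induction n with
  | zero => simp
  | succ n ih =>
    rw [Finset.sum_Icc_succ_top (by omega), add_mul, ih]
    ring

lemma eval_posPoly_exp_neg_le (n : ℕ) {s : ℝ} (hs : 0 < s) :
    (posPoly n).eval (Real.exp (-s)) ≤ s⁻¹ := by
  have hx := Real.exp_pos (-s)
  have hsx : s * Real.exp (-s) ≤ 1 - Real.exp (-s) := by
    have h := mul_le_mul_of_nonneg_right (Real.add_one_le_exp s) hx.le
    rw [← Real.exp_add, add_neg_cancel, Real.exp_zero] at h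
    linarith
  have h1 : 0 < 1 - Real.exp (-s) := lt_of_lt_of_le (by positivity) hsx
  have h2 := eval_posPoly_mul n (Real.exp (-s))
  have h3 : 0 < Real.exp (-s) ^ (n + 1) := by positivity
  calc (posPoly n).eval (Real.exp (-s)) ≤ Real.exp (-s) / (1 - Real.exp (-s)) := by
        rw [le_div_iff₀ h1]
        linarith
    _ ≤ s⁻¹ := by
        rw [div_le_iff₀ h1, inv_mul_eq_div, le_div_iff₀ hs]
        linarith

lemma ewensH_natCast_le {n : ℕ} (hn : 0 < n) :
    ewensH (fun k => (k : ℝ)) n ≤ Real.exp (2 * √n) := by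
  have hs : 0 < √(n : ℝ) := Real.sqrt_pos.2 (by exact_mod_cast hn)
  have h := ewensH_natCast_mul_pow_le n (Real.exp_pos (-(√(n : ℝ))⁻¹)).le
  have h2 := eval_posPoly_exp_neg_le n (inv_pos.2 hs)
  rw [inv_inv] at h2
  have h3 := h.trans (Real.exp_le_exp.2 h2)
  rw [← Real.exp_nat_mul] at h3
  have h4 : (n : ℝ) * -(√(n : ℝ))⁻¹ = -√n := by
    nth_rewrite 1 [← Real.mul_self_sqrt n.cast_nonneg]
    field_simp
  rw [h4, Real.exp_neg, mul_inv_le_iff₀ (Real.exp_pos _), ← Real.exp_add] at h3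
  rwa [two_mul]

lemma coeff_geomPoly_pow {n m : ℕ} (r : ℕ) (hm : m < n) :
    ((∑ j ∈ Finset.range n, (Polynomial.X : Polynomial ℝ) ^ j) ^ (r + 1)).coeff m =
      (m + r).choose r := by
  have hQ : ∀ i < n,
      (∑ j ∈ Finset.range n, (Polynomial.X : Polynomial ℝ) ^ j).coeff i = 1 := by
    intro i hi
    simp [Polynomial.finsetSum_coeff, Polynomial.coeff_X_pow, hi]
  induction r generalizing m with
  | zero => simpa using hQ m hm
  | succ r ih =>
    rw [pow_succ, Polynomial.coeff_mul,
      Finset.Nat.sum_antidiagonal_eq_sum_range_succ_mk, ← add_assoc, ← Nat.sum_range_add_choose]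
    push_cast
    refine Finset.sum_congr rfl fun i hi => ?_
    rw [Finset.mem_range] at hi
    rw [ih (by omega), hQ _ (by omega), mul_one]

lemma coeff_posPoly_pow_succ {n r : ℕ} (h : r < n) :
    (posPoly n ^ (r + 1)).coeff n = (n - 1).choose r := by
  have hP : posPoly n = (∑ j ∈ Finset.range n, (Polynomial.X : Polynomial ℝ) ^ j) *
      Polynomial.X := by
    rw [posPoly, Finset.sum_mul, ← Finset.Ico_add_one_right_eq_Icc, Finset.sum_Ico_eq_sum_range]
    simp [pow_add, mul_comm]
  rw [hP, mul_pow, Polynomial.coeff_mul_X_pow', if_pos (by omega),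
    coeff_geomPoly_pow r (by omega)]
  congr 2
  omega

lemma choose_div_factorial_le_ewensH {n r : ℕ} (h : r < n) :
    ((n - 1).choose r : ℝ) / (r + 1).factorial ≤ ewensH (fun k => (k : ℝ)) n := by
  rw [ewensH_natCast_eq_sum_coeff, ← coeff_posPoly_pow_succ h]
  exact Finset.single_le_sum (f := fun k => (posPoly n ^ k).coeff n / (k.factorial : ℝ))
    (fun k _ => div_nonneg (posPoly_pow_coeff_nonneg n k n) (by positivity))
    (Finset.mem_range.2 (Nat.succ_lt_succ h))

lemma exp_mul_factorial_le {r : ℕ} (hr : 1 ≤ r) :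
    Real.exp ((r : ℝ) - 1) * r.factorial ≤ (r : ℝ) ^ (r + 1) := by
  induction r, hr using Nat.le_induction with
  | base => simp
  | succ r hr ih =>
    have hr0 : (0 : ℝ) < r := by exact_mod_cast hr
    have hlog : (1 : ℝ) ≤ (r + 1 : ℕ) * Real.log ((r + 1) / r) := by
      have h := Real.one_sub_inv_le_log_of_pos (x := ((r : ℝ) + 1) / r) (by positivity)
      push_cast
      calc (1 : ℝ) = (r + 1) * (1 - (((r : ℝ) + 1) / r)⁻¹) := by field_simp; ring
        _ ≤ _ := by gcongr
    have hexp : Real.exp 1 ≤ (((r : ℝ) + 1) / r) ^ (r + 1) := by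
      rw [← Real.exp_log (show (0 : ℝ) < ((r : ℝ) + 1) / r by positivity), ← Real.exp_nat_mul]
      exact Real.exp_le_exp.2 hlog
    rw [div_pow, le_div_iff₀ (by positivity)] at hexp
    rw [Nat.factorial_succ]
    push_cast
    calc Real.exp ((r : ℝ) + 1 - 1) * ((r + 1) * r.factorial)
        = (r + 1) * (Real.exp 1 * (Real.exp ((r : ℝ) - 1) * r.factorial)) := by
          rw [show (r : ℝ) + 1 - 1 = 1 + (r - 1) by ring, Real.exp_add]
          ring
      _ ≤ (r + 1) * (Real.exp 1 * (r : ℝ) ^ (r + 1)) := by gcongr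
      _ ≤ (r + 1) * ((r : ℝ) + 1) ^ (r + 1) := by gcongr
      _ = ((r : ℝ) + 1) ^ (r + 1 + 1) := by ring

lemma exp_div_pow_le_ewensH {n r : ℕ} (hr : 1 ≤ r) (h : (r + 1) ^ 2 ≤ n) :
    Real.exp (2 * ((r : ℝ) - 1)) / ((r : ℝ) + 1) ^ 3 ≤ ewensH (fun k => (k : ℝ)) n := by
  have hr0 : (0 : ℝ) < r := by exact_mod_cast hr
  refine le_trans ?_ (choose_div_factorial_le_ewensH (n := n) (r := r) (by nlinarith))
  have h1 := Nat.pow_le_choose (α := ℝ) r (n - 1)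
  have h2 : (r : ℝ) * r ≤ ((n - 1 + 1 - r : ℕ) : ℝ) := by
    have : r * r ≤ n - 1 + 1 - r := by
      have : (r + 1) ^ 2 = r * r + 2 * r + 1 := by ring
      omega
    exact_mod_cast this
  have hf : (0 : ℝ) < r.factorial := by positivity
  have h3 : ((r : ℝ) * r) ^ r / r.factorial ≤ ((n - 1).choose r : ℝ) :=
    le_trans (by gcongr) h1
  have h4 := exp_mul_factorial_le hr
  rw [← le_div_iff₀ hf] at h4
  calc Real.exp (2 * ((r : ℝ) - 1)) / ((r : ℝ) + 1) ^ 3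
      = Real.exp ((r : ℝ) - 1) ^ 2 / ((r : ℝ) + 1) ^ 3 := by
        rw [← Real.exp_nat_mul]
        norm_num
    _ ≤ ((r : ℝ) ^ (r + 1) / r.factorial) ^ 2 / ((r : ℝ) ^ 2 * (r + 1)) := by
        gcongr
        nlinarith
    _ = ((r : ℝ) * r) ^ r / r.factorial / (r + 1).factorial := by
        rw [Nat.factorial_succ]
        push_cast
        field_simp
        ring
    _ ≤ _ := by gcongr

lemma le_log_ewensH {n : ℕ} (hn : 4 ≤ n) :
    2 * √n - 6 - 3 / 2 * Real.log n ≤ Real.log (ewensH (fun k => (k : ℝ)) n) := by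
  obtain ⟨r, hr⟩ : ∃ r, n.sqrt = r + 1 := ⟨n.sqrt - 1, by
    have : 2 ≤ n.sqrt := Nat.le_sqrt'.2 (by omega)
    omega⟩
  have hr1 : 1 ≤ r := by
    have : 2 ≤ n.sqrt := Nat.le_sqrt'.2 (by omega)
    omega
  have hsq : (r + 1) ^ 2 ≤ n := hr ▸ Nat.sqrt_le' n
  have h := exp_div_pow_le_ewensH hr1 hsq
  have hlog := Real.log_le_log (by positivity) h
  rw [Real.log_div (by positivity) (by positivity), Real.log_exp, Real.log_pow] at hlog
  have h1 : √(n : ℝ) ≤ r + 2 := by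
    have := Real.real_sqrt_le_nat_sqrt_succ (a := n)
    rw [hr] at this
    push_cast at this
    linarith
  have h2 : 2 * Real.log (r + 1) ≤ Real.log n := by
    have := Real.log_le_log (x := ((r : ℝ) + 1) ^ 2) (y := n) (by positivity) (by exact_mod_cast hsq)
    rwa [Real.log_pow] at this
  push_cast at hlog
  linarith

lemma ewensH_natCast_pos {n : ℕ} (hn : 4 ≤ n) : 0 < ewensH (fun k => (k : ℝ)) n := by
  have h := exp_div_pow_le_ewensH (n := n) le_rfl (by omega)
  exact lt_of_lt_of_le (by positivity) h

lemma tendsto_log_add_const_div_sqrt (a b : ℝ) :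
    Tendsto (fun n : ℕ => (a * Real.log n + b) / (2 * √n)) atTop (𝓝 0) := by
  have h1 : Tendsto (fun x : ℝ => Real.log x / √x) atTop (𝓝 0) := by
    have := (isLittleO_log_rpow_atTop (r := 1 / 2) (by norm_num)).tendsto_div_nhds_zero
    simpa only [Real.sqrt_eq_rpow] using this
  have h2 : Tendsto (fun x : ℝ => (√x)⁻¹) atTop (𝓝 0) :=
    Real.tendsto_sqrt_atTop.inv_tendsto_atTop
  have h3 := ((h1.const_mul (a / 2)).add (h2.const_mul (b / 2))).comp
    (tendsto_natCast_atTop_atTop (R := ℝ))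
  rw [mul_zero, mul_zero, add_zero] at h3
  refine h3.congr fun n => ?_
  simp only [Function.comp_apply]
  ring

/-- **Proposition 3.2 (first part).** For `θ_k = k` (so `g_θ(t) = (1-t)^{-1}` up
to the constant term) one has `h_n = (4π)^{-1/2} n^{-3/4} exp(2√n (1+o(1)))`. -/
theorem asymptotic_ewensH_simple :
    ∃ e : ℕ → ℝ, Tendsto e atTop (𝓝 0) ∧
      ∀ᶠ n : ℕ in atTop,
        ewensH (fun k => (k : ℝ)) n =
          (Real.sqrt (4 * Real.pi))⁻¹ * (n : ℝ) ^ (-(3 : ℝ) / 4) *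
            Real.exp (2 * Real.sqrt n * (1 + e n)) := by
  set c : ℝ := (√(4 * Real.pi))⁻¹ with hc
  have hc0 : 0 < c := by positivity
  refine ⟨fun n => (Real.log (ewensH (fun k => (k : ℝ)) n) - Real.log c + 3 / 4 * Real.log n) /
    (2 * √n) - 1, ?_, ?_⟩
  · refine tendsto_of_tendsto_of_tendsto_of_le_of_le'
      (tendsto_log_add_const_div_sqrt (-(3 / 4)) (-6 - Real.log c))
      (tendsto_log_add_const_div_sqrt (3 / 4) (-Real.log c)) ?_ ?_
    · filter_upwards [eventually_ge_atTop 4] with n hn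
      have hs : 0 < √(n : ℝ) := Real.sqrt_pos.2 (by exact_mod_cast (by omega : 0 < n))
      have h := le_log_ewensH hn
      rw [div_sub_one (by positivity)]
      gcongr
      linarith
    · filter_upwards [eventually_ge_atTop 4] with n hn
      have hs : 0 < √(n : ℝ) := Real.sqrt_pos.2 (by exact_mod_cast (by omega : 0 < n))
      have h := Real.log_le_log (ewensH_natCast_pos hn) (ewensH_natCast_le (by omega))
      rw [Real.log_exp] at h
      rw [div_sub_one (by positivity)]
      gcongr
      linarith
  · filter_upwards [eventually_ge_atTop 4] with n hn
    have hn0 : (0 : ℝ) < n := by exact_mod_cast (by omega : 0 < n)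
    have hs : 0 < √(n : ℝ) := Real.sqrt_pos.2 hn0
    rw [add_sub_cancel, mul_div_cancel₀ _ (by positivity), Real.exp_add, Real.exp_sub,
      Real.exp_log (ewensH_natCast_pos hn), Real.exp_log hc0, Real.rpow_def_of_pos hn0,
      show Real.log n * (-(3 : ℝ) / 4) = -(3 / 4 * Real.log n) by ring, Real.exp_neg]
    field_simp
end
end
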